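/- arXiv:2012.08211 — 2 statements merged into one kernel-verified Lean document; each statement's English description precedes it below -/
import Mathlib

section
/- Let p be a prime, let Q ∈ ℤ[X] be a polynomial in one variable, let α ≥ 1 be an integer, and write H_α = H_{p^{-α}Q}. Then there exists an integer a with p^{-1} < max(1, H_α) · p^{-α} · N_{a,α}, where N_{a,α} is the number of x ∈ {0,…,p^α−1} with Q(x) ≡ a (mod p^α); moreover, if H_α is an integer power of p, then there exists an integer a with 1 ≤ max(1, H_α) · p^{-α} · N_{a,α}. -/
open Polynomial

/-- `H_P(z) = max_{1 ≤ k ≤ deg P} |P^{(k)}(z)/k!|^{1/k}` (empty max = 0). -/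
noncomputable def Hfun {p : ℕ} [Fact p.Prime] (P : Polynomial ℚ_[p]) (z : ℤ_[p]) : NNReal :=
  (Finset.Icc 1 P.natDegree).sup fun k =>
    ‖(derivative^[k] P).eval (z : ℚ_[p]) / (k.factorial : ℚ_[p])‖₊ ^ ((1 : ℝ) / (k : ℝ))

/-- `H_P = inf_{z ∈ ℤ_p} H_P(z)`. -/
noncomputable def Hinf {p : ℕ} [Fact p.Prime] (P : Polynomial ℚ_[p]) : NNReal :=
  ⨅ z : ℤ_[p], Hfun P z

/-- The polynomial `p^{-α} Q` regarded as an element of `ℚ_p[X]`. -/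
noncomputable def padicScaled (p : ℕ) [Fact p.Prime] (α : ℕ) (Q : Polynomial ℤ) :
    Polynomial ℚ_[p] :=
  Polynomial.C (((p : ℚ_[p]) ^ α)⁻¹) * Q.map (Int.castRingHom ℚ_[p])

/-- The number of `x ∈ {0,…,p^α-1}` with `Q(x) ≡ a (mod p^α)`. -/
noncomputable def Ncount (p : ℕ) (α : ℕ) (Q : Polynomial ℤ) (a : ℤ) : ℕ :=
  ((Finset.range (p ^ α)).filter fun x : ℕ => ((p : ℤ) ^ α ∣ Q.eval ((x : ℤ)) - a)).card

theorem continuous_Hfun {p : ℕ} [Fact p.Prime] (P : Polynomial ℚ_[p]) : Continuous (Hfun P) := by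
  unfold Hfun
  refine Continuous.finset_sup_apply fun k _ => ?_
  refine (NNReal.continuous_rpow_const (by positivity)).comp (Continuous.nnnorm ?_)
  exact (((derivative^[k] P).continuous).comp continuous_subtype_val).div_const _

theorem exists_Hfun_eq_Hinf {p : ℕ} [Fact p.Prime] (P : Polynomial ℚ_[p]) :
    ∃ z : ℤ_[p], Hfun P z = Hinf P := by
  obtain ⟨z, -, hz⟩ := isCompact_univ.exists_isMinOn Set.univ_nonempty
    (continuous_Hfun P).continuousOn
  exact ⟨z, le_antisymm (le_ciInf fun w => hz (Set.mem_univ w)) (ciInf_le (OrderBot.bddBelow _) z)⟩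

theorem taylor_coeff_eq_iterate_derivative_div {K : Type*} [Field K] [CharZero K]
    (P : Polynomial K) (z : K) (k : ℕ) :
    (taylor z P).coeff k = (derivative^[k] P).eval z / (k.factorial : K) := by
  rw [taylor_coeff, ← factorial_smul_hasseDeriv, eq_div_iff (mod_cast k.factorial_ne_zero)]
  simp [mul_comm]

theorem norm_eval_sub_eval_le_one {p : ℕ} [Fact p.Prime] (P : Polynomial ℚ_[p]) (z : ℤ_[p])
    (j : ℕ) (hz : (Hfun P z : ℝ) ≤ (p : ℝ) ^ j) (x : ℚ_[p])
    (hx : ‖x - z‖ ≤ ((p : ℝ) ^ j)⁻¹) :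
    ‖P.eval x - P.eval (z : ℚ_[p])‖ ≤ 1 := by
  have hp : (0 : ℝ) < p := mod_cast (Fact.out : p.Prime).pos
  have hexp : P.eval x - P.eval (z : ℚ_[p]) =
      ∑ k ∈ Finset.range P.natDegree,
        (taylor (z : ℚ_[p]) P).coeff (k + 1) * (x - z) ^ (k + 1) := by
    have h := taylor_eval (z : ℚ_[p]) P (x - z)
    rw [sub_add_cancel, eval_eq_sum_range, natDegree_taylor, Finset.sum_range_succ'] at h
    rw [← h]
    simp
  rw [hexp]
  refine IsUltrametricDist.norm_sum_le_of_forall_le_of_nonneg zero_le_one fun k hk => ?_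
  have hk' : k + 1 ∈ Finset.Icc 1 P.natDegree := by
    simp only [Finset.mem_range, Finset.mem_Icc] at hk ⊢
    omega
  have hc : ‖(taylor (z : ℚ_[p]) P).coeff (k + 1)‖ ≤ ((p : ℝ) ^ j) ^ (k + 1) := by
    rw [taylor_coeff_eq_iterate_derivative_div]
    have h1 := Finset.le_sup (f := fun k =>
      ‖(derivative^[k] P).eval (z : ℚ_[p]) / (k.factorial : ℚ_[p])‖₊ ^ ((1 : ℝ) / (k : ℝ))) hk'
    have h2 := (NNReal.coe_le_coe.2 h1).trans hz
    rw [NNReal.coe_rpow, coe_nnnorm, one_div] at h2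
    have h3 := pow_le_pow_left₀ (by positivity) h2 (k + 1)
    rwa [Real.rpow_inv_natCast_pow (norm_nonneg _) (Nat.succ_ne_zero k)] at h3
  rw [norm_mul, norm_pow]
  calc _ ≤ ((p : ℝ) ^ j) ^ (k + 1) * (((p : ℝ) ^ j)⁻¹) ^ (k + 1) := by gcongr
    _ = 1 := by rw [← mul_pow, mul_inv_cancel₀ (by positivity), one_pow]

theorem dvd_eval_sub_eval_of_norm_sub_le {p : ℕ} [Fact p.Prime] (Q : Polynomial ℤ) (α : ℕ)
    (z : ℤ_[p]) (j : ℕ) (hz : (Hfun (padicScaled p α Q) z : ℝ) ≤ (p : ℝ) ^ j) (x y : ℤ)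
    (hx : ‖(x : ℚ_[p]) - z‖ ≤ ((p : ℝ) ^ j)⁻¹) (hy : ‖(y : ℚ_[p]) - z‖ ≤ ((p : ℝ) ^ j)⁻¹) :
    (p : ℤ) ^ α ∣ Q.eval x - Q.eval y := by
  have hp : (0 : ℝ) < p := mod_cast (Fact.out : p.Prime).pos
  have heval (n : ℤ) : (padicScaled p α Q).eval (n : ℚ_[p]) =
      ((p : ℚ_[p]) ^ α)⁻¹ * ((Q.eval n : ℤ) : ℚ_[p]) := by
    simp [padicScaled, eval_intCast_map]
  have h : ‖(padicScaled p α Q).eval (x : ℚ_[p]) - (padicScaled p α Q).eval (y : ℚ_[p])‖ ≤ 1 := by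
    rw [← dist_eq_norm]
    refine (dist_triangle_max _ ((padicScaled p α Q).eval (z : ℚ_[p])) _).trans (max_le ?_ ?_)
    · rw [dist_eq_norm]
      exact norm_eval_sub_eval_le_one _ z j hz _ hx
    · rw [dist_comm, dist_eq_norm]
      exact norm_eval_sub_eval_le_one _ z j hz _ hy
  rw [heval, heval, ← mul_sub, norm_mul, norm_inv, norm_pow, Padic.norm_p, ← Int.cast_sub,
    inv_pow, inv_inv, ← le_inv_mul_iff₀ (by positivity), mul_one] at h
  have h' := (Padic.norm_int_le_pow_iff_dvd (p := p) (Q.eval x - Q.eval y) α).1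
    (by simpa [zpow_neg] using h)
  exact_mod_cast h'

theorem exists_pow_le_Ncount {p : ℕ} [Fact p.Prime] (Q : Polynomial ℤ) (α : ℕ) (j : ℕ)
    (hj : j ≤ α) (h : (Hinf (padicScaled p α Q) : ℝ) ≤ (p : ℝ) ^ j) :
    ∃ a : ℤ, p ^ (α - j) ≤ Ncount p α Q a := by
  have hp : 0 < p := (Fact.out : p.Prime).pos
  obtain ⟨z, hz⟩ := exists_Hfun_eq_Hinf (padicScaled p α Q)
  rw [← hz] at h
  set r := z.appr j
  have hr : r < p ^ j := z.appr_lt j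
  have hnear (i : ℕ) : ‖(((r + p ^ j * i : ℕ) : ℤ) : ℚ_[p]) - z‖ ≤ ((p : ℝ) ^ j)⁻¹ := by
    have h1 : z - ((r + p ^ j * i : ℕ) : ℤ_[p]) ∈ Ideal.span {(p : ℤ_[p]) ^ j} := by
      have : z - ((r + p ^ j * i : ℕ) : ℤ_[p]) = (z - r) - (p : ℤ_[p]) ^ j * i := by
        push_cast; ring
      rw [this]
      exact sub_mem (z.appr_spec j) (Ideal.mul_mem_right _ _ (Ideal.mem_span_singleton_self _))
    have h2 := (PadicInt.norm_le_pow_iff_mem_span_pow _ _).2 h1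
    rw [zpow_neg, zpow_natCast, PadicInt.norm_def, ← norm_neg] at h2
    simpa using h2
  refine ⟨Q.eval ((r + p ^ j * 0 : ℕ) : ℤ), ?_⟩
  unfold Ncount
  rw [← Finset.card_range (p ^ (α - j))]
  refine Finset.card_le_card_of_injOn (fun i => r + p ^ j * i) (fun i hi => ?_) ?_
  · simp only [Finset.coe_range, Set.mem_Iio] at hi
    simp only [Finset.coe_filter, Finset.mem_range, Set.mem_ofPred_eq]
    refine ⟨?_, dvd_eval_sub_eval_of_norm_sub_le Q α z j h _ _ (hnear i) (hnear 0)⟩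
    calc r + p ^ j * i < p ^ j * (i + 1) := by rw [mul_add_one]; omega
      _ ≤ p ^ j * p ^ (α - j) := Nat.mul_le_mul_left _ hi
      _ = p ^ α := by rw [← pow_add, Nat.add_sub_cancel' hj]
  · intro a _ b _ hab
    exact Nat.eq_of_mul_eq_mul_left (pow_pos hp j) (Nat.add_left_cancel hab)

theorem exists_pow_le_pow_mul_Ncount {p : ℕ} [Fact p.Prime] (Q : Polynomial ℤ) (α : ℕ) (j : ℕ)
    (h : (Hinf (padicScaled p α Q) : ℝ) ≤ (p : ℝ) ^ j) :
    ∃ a : ℤ, (p : ℝ) ^ α ≤ (p : ℝ) ^ j * (Ncount p α Q a : ℝ) := by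
  have hp : 0 < p := (Fact.out : p.Prime).pos
  rcases le_total j α with hj | hj
  · obtain ⟨a, ha⟩ := exists_pow_le_Ncount Q α j hj h
    refine ⟨a, ?_⟩
    rw [← Nat.add_sub_cancel' hj, pow_add, Nat.add_sub_cancel' hj]
    gcongr
    exact_mod_cast ha
  · refine ⟨Q.eval 0, ?_⟩
    have hN : 0 < Ncount p α Q (Q.eval 0) :=
      Finset.card_pos.2 ⟨0, by simp [hp]⟩
    have : p ^ α ≤ p ^ j * Ncount p α Q (Q.eval 0) :=
      (Nat.pow_le_pow_right hp hj).trans (Nat.le_mul_of_pos_right _ hN)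
    exact_mod_cast this

theorem exists_one_le_max_mul_Ncount {p : ℕ} [Fact p.Prime] (Q : Polynomial ℤ) (α : ℕ) (j : ℕ)
    (h : max 1 (Hinf (padicScaled p α Q) : ℝ) = (p : ℝ) ^ j) :
    ∃ a : ℤ,
      1 ≤ max 1 (Hinf (padicScaled p α Q) : ℝ) * (((p : ℝ) ^ α)⁻¹ * (Ncount p α Q a : ℝ)) := by
  have hp : (0 : ℝ) < p := mod_cast (Fact.out : p.Prime).pos
  obtain ⟨a, ha⟩ := exists_pow_le_pow_mul_Ncount Q α j ((le_max_right _ _).trans_eq h)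
  refine ⟨a, ?_⟩
  rw [h, mul_left_comm, ← div_eq_inv_mul]
  exact (one_le_div₀ (by positivity)).2 ha

/-- Lower bound in Proposition 1.6 for `n = 1`: there is an integer `a` with
`p^{-1} < max(1, H_α) · p^{-α} · N_{a,α}`; moreover if `H_α` is an integer power of `p`
then there is `a` with `1 ≤ max(1, H_α) · p^{-α} · N_{a,α}`. -/
theorem congruence_count_lower_bound (p : ℕ) [Fact p.Prime] (Q : Polynomial ℤ)
    (α : ℕ) (hα : 1 ≤ α) :
    (∃ a : ℤ,
      (p : ℝ)⁻¹ <
        max 1 (Hinf (padicScaled p α Q) : ℝ) * (((p : ℝ) ^ α)⁻¹ * (Ncount p α Q a : ℝ))) ∧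
    ((∃ k : ℤ, ((Hinf (padicScaled p α Q) : ℝ)) = (p : ℝ) ^ k) →
      ∃ a : ℤ,
        1 ≤ max 1 (Hinf (padicScaled p α Q) : ℝ) * (((p : ℝ) ^ α)⁻¹ * (Ncount p α Q a : ℝ))) := by
  have hp : (1 : ℝ) < p := mod_cast (Fact.out : p.Prime).one_lt
  have hp0 : (0 : ℝ) < p := zero_lt_one.trans hp
  refine ⟨?_, ?_⟩
  · obtain ⟨n, hn, hn'⟩ :=
      exists_nat_pow_near (le_max_left 1 (Hinf (padicScaled p α Q) : ℝ)) hp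
    rcases hn.eq_or_lt with heq | hlt
    · obtain ⟨a, ha⟩ := exists_one_le_max_mul_Ncount Q α n heq.symm
      exact ⟨a, (inv_lt_one_of_one_lt₀ hp).trans_le ha⟩
    · obtain ⟨a, ha⟩ := exists_pow_le_pow_mul_Ncount Q α (n + 1) ((le_max_right _ _).trans hn'.le)
      have hN : (0 : ℝ) < Ncount p α Q a :=
        pos_of_mul_pos_right ((pow_pos hp0 α).trans_le ha) (by positivity)
      refine ⟨a, ?_⟩
      calc (p : ℝ)⁻¹ = (p : ℝ)⁻¹ * (((p : ℝ) ^ α)⁻¹ * (p : ℝ) ^ α) := by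
            rw [inv_mul_cancel₀ (by positivity), mul_one]
        _ ≤ (p : ℝ)⁻¹ * (((p : ℝ) ^ α)⁻¹ * ((p : ℝ) ^ (n + 1) * (Ncount p α Q a : ℝ))) := by gcongr
        _ = (p : ℝ) ^ n * (((p : ℝ) ^ α)⁻¹ * (Ncount p α Q a : ℝ)) := by field_simp; ring
        _ < _ := by gcongr
  · rintro ⟨k, hk⟩
    rcases le_total 0 k with h0 | h0
    · lift k to ℕ using h0
      refine exists_one_le_max_mul_Ncount Q α k ?_
      rw [hk, zpow_natCast, max_eq_right (one_le_pow₀ hp.le)]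
    · refine exists_one_le_max_mul_Ncount Q α 0 ?_
      rw [hk, pow_zero, max_eq_left (zpow_le_one_of_nonpos₀ hp.le h0)]
end

section
/- Let p be a prime, let r ≥ 1 be an integer, and let a₀, b₀ be integers with p ∤ a₀ and p ∤ b₀ such that the congruence 3·a₀·s² + b₀ ≡ 0 (mod p) has no integer solution s. Set M = 3r − 2. Then p^{-M} · Σ_{x=0}^{p^M−1} exp(2πi·(a₀·x³ + p^{2r−2}·b₀·x)/p^M) = p^{-r} · Σ_{x=0}^{p−1} exp(2πi·(a₀·x³ + b₀·x)/p). -/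
open Finset in
theorem sum_range_natCast_zmod {A : Type*} [AddCommMonoid A] (N : ℕ) [NeZero N]
    (F : ZMod N → A) : ∑ x ∈ range N, F (x : ZMod N) = ∑ x : ZMod N, F x := by
  refine sum_bij' (fun x _ => (x : ZMod N)) (fun x _ => x.val) ?_ ?_ ?_ ?_ ?_
  · simp
  · intro x _
    simpa using x.val_lt
  · intro x hx
    exact ZMod.val_cast_of_lt (by simpa using hx)
  · simp
  · simp

theorem ZMod.natCast_dvd_natCast_iff_of_dvd {N d : ℕ} (h : d ∣ N) (x : ℕ) :
    (d : ZMod N) ∣ (x : ZMod N) ↔ d ∣ x := by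
  refine ⟨fun hx => ?_, fun hx => Nat.cast_dvd_cast hx⟩
  have h1 := map_dvd (ZMod.castHom h (ZMod d)) hx
  rw [map_natCast, map_natCast, ZMod.natCast_self, zero_dvd_iff] at h1
  exact (ZMod.natCast_eq_zero_iff x d).1 h1

open Finset in
theorem sum_range_mul_ite_dvd {A : Type*} [AddCommMonoid A] {m : ℕ} (hm : 0 < m) (n : ℕ)
    (g : ℕ → A) :
    ∑ x ∈ range (m * n), (if m ∣ x then g x else 0) = ∑ t ∈ range n, g (m * t) := by
  rw [← sum_filter]
  symm
  refine sum_bij (fun t _ => m * t) ?_ ?_ ?_ ?_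
  · intro t ht
    simpa [hm] using ht
  · intro a _ b _ h
    exact Nat.eq_of_mul_eq_mul_left hm h
  · intro x hx
    obtain ⟨hx1, t, rfl⟩ := mem_filter.1 hx
    exact ⟨t, by simpa [hm] using hx1, rfl⟩
  · simp

open Finset in
theorem Function.Periodic.sum_range_mul {A : Type*} [AddCommMonoid A] {g : ℕ → A} {n : ℕ}
    (hg : Function.Periodic g n) (q : ℕ) :
    ∑ x ∈ range (n * q), g x = q • ∑ x ∈ range n, g x := by
  induction q with
  | zero => simp
  | succ q ih =>
    rw [Nat.mul_succ, sum_range_add, ih, succ_nsmul]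
    congr 1
    refine sum_congr rfl fun x _ => ?_
    rw [add_comm, mul_comm]
    exact hg.nat_mul q x

/-- If translation by multiples of `h` preserves `P` and multiplies `ψ (f x)` by a nontrivial
character, then the sum of `ψ ∘ f` over `P` vanishes. -/
theorem sum_ite_stdAddChar_eq_zero {N : ℕ} [NeZero N] (P : ZMod N → Prop) [DecidablePred P]
    (f c : ZMod N → ZMod N) (h : ZMod N) (hP : ∀ x z, P (x + h * z) ↔ P x)
    (hf : ∀ x z, P x → f (x + h * z) = f x + z * c x) (hc : ∀ x, P x → c x ≠ 0) :
    ∑ x : ZMod N, (if P x then ZMod.stdAddChar (f x) else 0) = 0 := by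
  have key : (N : ℂ) * ∑ x : ZMod N, (if P x then ZMod.stdAddChar (f x) else 0) = 0 := by
    calc (N : ℂ) * ∑ x : ZMod N, (if P x then ZMod.stdAddChar (f x) else 0)
        = ∑ z : ZMod N, ∑ x : ZMod N,
            (if P (x + h * z) then ZMod.stdAddChar (f (x + h * z)) else 0) := by
          have hz : ∀ z : ZMod N,
              ∑ x, (if P (x + h * z) then (ZMod.stdAddChar (f (x + h * z)) : ℂ) else 0) =
                ∑ x, (if P x then (ZMod.stdAddChar (f x) : ℂ) else 0) := fun z =>
            Equiv.sum_comp (Equiv.addRight (h * z))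
              fun x => if P x then (ZMod.stdAddChar (f x) : ℂ) else 0
          simp [hz]
      _ = ∑ x : ZMod N, ∑ z : ZMod N,
            (if P (x + h * z) then ZMod.stdAddChar (f (x + h * z)) else 0) := Finset.sum_comm
      _ = 0 := by
          refine Finset.sum_eq_zero fun x _ => ?_
          by_cases hx : P x
          · simp only [hP, hx, if_true, hf x _ hx, AddChar.map_add_eq_mul]
            rw [← Finset.mul_sum, AddChar.sum_mulShift _ (ZMod.isPrimitive_stdAddChar N),
              if_neg (hc x hx)]
            simp
          · simp [hP, hx]
  exact (mul_eq_zero.1 key).resolve_left (Nat.cast_ne_zero.2 (NeZero.ne N))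

/-- Expansion of the cubic phase around a point of valuation `j < s`, where `v` is the valuation
of `3`. -/
theorem cubic_phase_shift {R : Type*} [CommRing R] {p w : R} {s j v : ℕ} (hj : j < s)
    (hv : v ≤ 1) (hp : p ^ (3 * s + 1) = 0) (hw : 3 = p ^ v * w) (a b u z : R) :
    a * (p ^ j * u + p ^ (3 * s - 2 * j - v) * z) ^ 3 +
        p ^ (2 * s) * b * (p ^ j * u + p ^ (3 * s - 2 * j - v) * z) =
      a * (p ^ j * u) ^ 3 + p ^ (2 * s) * b * (p ^ j * u) +
        z * (p ^ (3 * s) * (w * a * u ^ 2)) := by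
  obtain ⟨k, hk⟩ : ∃ k, 3 * s - 2 * j - v = k := ⟨_, rfl⟩
  have hz : ∀ n, 3 * s + 1 ≤ n → p ^ n = 0 := fun n hn => pow_eq_zero_of_le hn hp
  have h1 : p ^ v * p ^ j * (p ^ k) ^ 2 = 0 := by
    rw [← pow_mul, ← pow_add, ← pow_add]; exact hz _ (by omega)
  have h2 : (p ^ k) ^ 3 = 0 := by rw [← pow_mul]; exact hz _ (by omega)
  have h3 : p ^ (2 * s) * p ^ k = 0 := by rw [← pow_add]; exact hz _ (by omega)
  have h4 : p ^ (3 * s) = p ^ v * (p ^ j) ^ 2 * p ^ k := by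
    rw [← pow_mul, ← pow_add, ← pow_add]; congr 1; omega
  rw [hk, h4]
  linear_combination (a * w * u * z ^ 2) * h1 + (a * z ^ 3) * h2 + (b * z) * h3 +
    (a * (p ^ j * u) ^ 2 * (p ^ k * z) + a * (p ^ j * u) * (p ^ k * z) ^ 2) * hw

theorem Nat.Prime.exists_three_eq_pow_mul {p : ℕ} (hp : p.Prime) :
    ∃ v w : ℕ, v ≤ 1 ∧ 3 = p ^ v * w ∧ ¬ p ∣ w := by
  by_cases h : p = 3
  · subst h
    exact ⟨1, 1, le_rfl, by norm_num, by norm_num⟩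
  · exact ⟨0, 3, by norm_num, by norm_num,
      fun h3 => h ((Nat.prime_dvd_prime_iff_eq hp Nat.prime_three).1 h3)⟩

/-- The phase `a x³ + p^{2s} b x` modulo `p^{3s+1}`. -/
def cubicPhase (p s : ℕ) (a b : ℤ) (x : ZMod (p ^ (3 * s + 1))) : ZMod (p ^ (3 * s + 1)) :=
  a * x ^ 3 + (p : ZMod (p ^ (3 * s + 1))) ^ (2 * s) * b * x

/-- Points of valuation exactly `j < s` do not contribute to the cubic exponential sum. -/
theorem sum_cubic_valuation_eq_zero {p s j : ℕ} (hp : p.Prime) (hj : j < s) {a : ℤ} (b : ℤ)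
    (ha : ¬ (p : ℤ) ∣ a) [NeZero (p ^ (3 * s + 1))]
    [DecidablePred fun x : ZMod (p ^ (3 * s + 1)) =>
      (p : ZMod (p ^ (3 * s + 1))) ^ j ∣ x ∧ ¬ (p : ZMod (p ^ (3 * s + 1))) ^ (j + 1) ∣ x] :
    ∑ x : ZMod (p ^ (3 * s + 1)),
      (if (p : ZMod (p ^ (3 * s + 1))) ^ j ∣ x ∧ ¬ (p : ZMod (p ^ (3 * s + 1))) ^ (j + 1) ∣ x
        then ZMod.stdAddChar (cubicPhase p s a b x)
        else (0 : ℂ)) = 0 := by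
  obtain ⟨v, w, hv, hw, hpw⟩ := hp.exists_three_eq_pow_mul
  have hpM : (p : ZMod (p ^ (3 * s + 1))) ^ (3 * s + 1) = 0 := by
    rw [← Nat.cast_pow, ZMod.natCast_self]
  have hwR : (3 : ZMod (p ^ (3 * s + 1))) = (p : ZMod (p ^ (3 * s + 1))) ^ v * w := by
    exact_mod_cast congrArg (Nat.cast : ℕ → ZMod (p ^ (3 * s + 1))) hw
  have hcof : ∀ x : ZMod (p ^ (3 * s + 1)), ∃ u : ZMod (p ^ (3 * s + 1)),
      (p : ZMod (p ^ (3 * s + 1))) ^ j ∣ x → x = (p : ZMod (p ^ (3 * s + 1))) ^ j * u := by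
    intro x
    by_cases hx : (p : ZMod (p ^ (3 * s + 1))) ^ j ∣ x
    · obtain ⟨u, hu⟩ := hx
      exact ⟨u, fun _ => hu⟩
    · exact ⟨0, fun h => absurd h hx⟩
  choose u hu using hcof
  refine sum_ite_stdAddChar_eq_zero _ _
    (fun x => (p : ZMod (p ^ (3 * s + 1))) ^ (3 * s) * (w * a * u x ^ 2))
    ((p : ZMod (p ^ (3 * s + 1))) ^ (3 * s - 2 * j - v)) ?_ ?_ ?_
  · intro x z
    rw [dvd_add_left (Dvd.dvd.mul_right (pow_dvd_pow _ (by omega)) z),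
      dvd_add_left (Dvd.dvd.mul_right (pow_dvd_pow _ (by omega)) z)]
  · intro x z hx
    have := cubic_phase_shift hj hv hpM hwR (a : ZMod (p ^ (3 * s + 1))) b (u x) z
    rw [← hu x hx.1] at this
    exact this
  · intro x hx h0
    obtain ⟨n, hn⟩ := ZMod.intCast_surjective (u x)
    have hpn : ¬ (p : ℤ) ∣ n := by
      rintro ⟨m, rfl⟩
      refine hx.2 ⟨m, ?_⟩
      rw [hu x hx.1, ← hn]
      push_cast
      ring
    have h1 : (((p ^ (3 * s) * (w * a * n ^ 2) : ℤ)) : ZMod (p ^ (3 * s + 1))) = 0 := by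
      push_cast
      rw [hn]
      exact h0
    rw [ZMod.intCast_zmod_eq_zero_iff_dvd] at h1
    push_cast at h1
    rw [pow_succ] at h1
    have hpZ : Prime (p : ℤ) := Nat.prime_iff_prime_int.1 hp
    have h2 := (mul_dvd_mul_iff_left (pow_ne_zero _ hpZ.ne_zero)).1 h1
    rcases hpZ.dvd_or_dvd h2 with h3 | h3
    · rcases hpZ.dvd_or_dvd h3 with h4 | h4
      · exact hpw (Int.natCast_dvd_natCast.1 h4)
      · exact ha h4
    · exact hpn (hpZ.dvd_of_dvd_pow h3)

open Classical in
/-- Only multiples of `p ^ j`, `j ≤ s`, contribute to the cubic exponential sum. -/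
theorem sum_cubic_eq_sum_ite_dvd {p s : ℕ} (hp : p.Prime) {a : ℤ} (b : ℤ) (ha : ¬ (p : ℤ) ∣ a)
    [NeZero (p ^ (3 * s + 1))] {j : ℕ} (hj : j ≤ s) :
    ∑ x : ZMod (p ^ (3 * s + 1)),
        (ZMod.stdAddChar (cubicPhase p s a b x) : ℂ) =
      ∑ x : ZMod (p ^ (3 * s + 1)), (if (p : ZMod (p ^ (3 * s + 1))) ^ j ∣ x
        then ZMod.stdAddChar (cubicPhase p s a b x)
        else (0 : ℂ)) := by
  induction j with
  | zero => simp
  | succ j ih =>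
    rw [ih (by omega), ← sub_eq_zero, ← Finset.sum_sub_distrib]
    refine Eq.trans ?_ (sum_cubic_valuation_eq_zero (s := s) hp (Nat.lt_of_succ_le hj) b ha)
    refine Finset.sum_congr rfl fun x _ => ?_
    have hdvd : (p : ZMod (p ^ (3 * s + 1))) ^ (j + 1) ∣ x →
        (p : ZMod (p ^ (3 * s + 1))) ^ j ∣ x := (pow_dvd_pow _ (Nat.le_succ j)).trans
    by_cases h1 : (p : ZMod (p ^ (3 * s + 1))) ^ (j + 1) ∣ x
    · simp [h1, hdvd h1]
    · simp [h1]


/-- The computation of Section 5: with `M = 3r - 2`, the normalized complete exponential sum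
of `a₀x³ + p^{2r-2}b₀x` modulo `p^M` reduces to `p^{-r}` times an exponential sum over the
finite field `ℤ/pℤ`. -/
theorem exp_sum_reduction (p : ℕ) (hp : p.Prime) (r : ℕ) (hr : 1 ≤ r) (a₀ b₀ : ℤ)
    (ha₀ : ¬ (p : ℤ) ∣ a₀) (hb₀ : ¬ (p : ℤ) ∣ b₀)
    (hcong : ¬ ∃ s : ℤ, (p : ℤ) ∣ (3 * a₀ * s ^ 2 + b₀)) :
    ((p : ℂ) ^ (3 * r - 2))⁻¹ *
        ∑ x ∈ Finset.range (p ^ (3 * r - 2)),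
          Complex.exp (2 * (Real.pi : ℂ) * Complex.I *
            ((a₀ * (x : ℤ) ^ 3 + (p : ℤ) ^ (2 * r - 2) * b₀ * (x : ℤ) : ℤ) : ℂ) /
            (p : ℂ) ^ (3 * r - 2)) =
      ((p : ℂ) ^ r)⁻¹ *
        ∑ x ∈ Finset.range p,
          Complex.exp (2 * (Real.pi : ℂ) * Complex.I *
            ((a₀ * (x : ℤ) ^ 3 + b₀ * (x : ℤ) : ℤ) : ℂ) / (p : ℂ)) := by
  obtain ⟨s, rfl⟩ : ∃ s, r = s + 1 := ⟨r - 1, by omega⟩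
  have hM : 3 * (s + 1) - 2 = 3 * s + 1 := by omega
  have h2s : 2 * (s + 1) - 2 = 2 * s := by omega
  rw [hM, h2s]
  have hp0 : (p : ℂ) ≠ 0 := Nat.cast_ne_zero.2 hp.ne_zero
  have : NeZero p := ⟨hp.ne_zero⟩
  have : NeZero (p ^ (3 * s + 1)) := ⟨pow_ne_zero _ hp.ne_zero⟩
  have hexp : ∀ x : ℕ, Complex.exp (2 * (Real.pi : ℂ) * Complex.I *
      ((a₀ * (x : ℤ) ^ 3 + (p : ℤ) ^ (2 * s) * b₀ * (x : ℤ) : ℤ) : ℂ) / (p : ℂ) ^ (3 * s + 1)) =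
      ZMod.stdAddChar (cubicPhase p s a₀ b₀ x) := by
    intro x
    have h := ZMod.stdAddChar_coe (N := p ^ (3 * s + 1))
      (a₀ * (x : ℤ) ^ 3 + (p : ℤ) ^ (2 * s) * b₀ * (x : ℤ))
    rw [cubicPhase]
    push_cast at h ⊢
    exact h.symm
  have hexp' : ∀ x : ℕ, Complex.exp (2 * (Real.pi : ℂ) * Complex.I *
      ((a₀ * (x : ℤ) ^ 3 + b₀ * (x : ℤ) : ℤ) : ℂ) / (p : ℂ)) =
      ZMod.stdAddChar ((a₀ : ZMod p) * (x : ZMod p) ^ 3 + (b₀ : ZMod p) * (x : ZMod p)) := by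
    intro x
    have h := ZMod.stdAddChar_coe (N := p) (a₀ * (x : ℤ) ^ 3 + b₀ * (x : ℤ))
    push_cast at h ⊢
    exact h.symm
  have hscale : ∀ t : ℕ,
      (ZMod.stdAddChar (cubicPhase p s a₀ b₀ ((p ^ s * t : ℕ) : ZMod (p ^ (3 * s + 1)))) : ℂ) =
      ZMod.stdAddChar ((a₀ : ZMod p) * (t : ZMod p) ^ 3 + (b₀ : ZMod p) * (t : ZMod p)) := by
    intro t
    rw [← hexp, ← hexp']
    congr 1
    rw [div_eq_div_iff (pow_ne_zero _ hp0) hp0]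
    push_cast
    ring
  have hper : Function.Periodic
      (fun t : ℕ => (ZMod.stdAddChar ((a₀ : ZMod p) * (t : ZMod p) ^ 3 + (b₀ : ZMod p) * (t : ZMod p)) : ℂ)) p := by
    intro t
    simp
  have hsplit : p ^ (3 * s + 1) = p ^ s * (p * p ^ (2 * s)) := by ring
  classical
  simp_rw [hexp, hexp']
  rw [sum_range_natCast_zmod (p ^ (3 * s + 1)) fun x =>
      (ZMod.stdAddChar (cubicPhase p s a₀ b₀ x) : ℂ),
    sum_cubic_eq_sum_ite_dvd hp b₀ ha₀ le_rfl, ← sum_range_natCast_zmod]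
  have hdvd : ∀ x : ℕ, (p : ZMod (p ^ (3 * s + 1))) ^ s ∣ (x : ZMod (p ^ (3 * s + 1))) ↔
      p ^ s ∣ x := by
    intro x
    rw [← Nat.cast_pow]
    exact ZMod.natCast_dvd_natCast_iff_of_dvd (pow_dvd_pow p (by omega)) x
  simp only [hdvd]
  rw [congrArg Finset.range hsplit, sum_range_mul_ite_dvd (pow_pos hp.pos s)]
  simp_rw [hscale]
  rw [hper.sum_range_mul, nsmul_eq_mul, ← mul_assoc]
  congr 1
  push_cast
  field_simp
  ring
end
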